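/- arXiv:1804.02008 — 9 statements merged into one kernel-verified Lean document; each statement's English description precedes it below -/
import Mathlib

section
/- Suppose that for every Y ∈ ℳ_p the matrices A_1 Y, …, A_m Y are linearly independent in ℝ^{n×p}. Then for every integer p' with 1 ≤ p' ≤ p and ℳ_{p'} nonempty, and every Y' ∈ ℳ_{p'}, the matrices A_1 Y', …, A_m Y' are linearly independent in ℝ^{n×p'}. Moreover, if this linear independence holds for p = n (i.e., for every Y ∈ ℳ_n), then it holds for every integer p' ≥ 1 such that ℳ_{p'} is nonempty, including p' > n. -/
open Matrix MeasureTheory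

noncomputable section

/-- Frobenius inner product ⟨A,B⟩ = trace(AᵀB). -/
def ip {n p : ℕ} (A B : Matrix (Fin n) (Fin p) ℝ) : ℝ := Matrix.trace (Aᵀ * B)

/-- The constraint map 𝒜(X)ᵢ = trace(Aᵢ X). -/
def calA {n m : ℕ} (A : Fin m → Matrix (Fin n) (Fin n) ℝ) (X : Matrix (Fin n) (Fin n) ℝ) :
    Fin m → ℝ := fun i => Matrix.trace (A i * X)

/-- The adjoint 𝒜*(ν) = ∑ νᵢ Aᵢ. -/
def adjA {n m : ℕ} (A : Fin m → Matrix (Fin n) (Fin n) ℝ) (ν : Fin m → ℝ) :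
    Matrix (Fin n) (Fin n) ℝ := ∑ i, ν i • A i

/-- ℳ_p = {Y ∈ ℝ^{n×p} : 𝒜(YYᵀ) = b}. -/
def MM {n m : ℕ} (A : Fin m → Matrix (Fin n) (Fin n) ℝ) (b : Fin m → ℝ) (p : ℕ) :
    Set (Matrix (Fin n) (Fin p) ℝ) := {Y | calA A (Y * Yᵀ) = b}

/-- 𝒞 = {X ∈ Sym(n,ℝ) : 𝒜(X) = b, X ⪰ 0}. -/
def CC {n m : ℕ} (A : Fin m → Matrix (Fin n) (Fin n) ℝ) (b : Fin m → ℝ) :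
    Set (Matrix (Fin n) (Fin n) ℝ) := {X | X.IsSymm ∧ calA A X = b ∧ X.PosSemidef}

/-- Gram matrix G(Y)ᵢⱼ = ⟨AᵢY, AⱼY⟩. -/
def gram {n m p : ℕ} (A : Fin m → Matrix (Fin n) (Fin n) ℝ) (Y : Matrix (Fin n) (Fin p) ℝ) :
    Matrix (Fin m) (Fin m) ℝ := Matrix.of fun i j => ip (A i * Y) (A j * Y)

/-- S(Y) = C − 𝒜*(G(Y)⁻¹ 𝒜(C Y Yᵀ)). -/
def Smat {n m p : ℕ} (A : Fin m → Matrix (Fin n) (Fin n) ℝ) (C : Matrix (Fin n) (Fin n) ℝ)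
    (Y : Matrix (Fin n) (Fin p) ℝ) : Matrix (Fin n) (Fin n) ℝ :=
  C - adjA A ((gram A Y)⁻¹ *ᵥ calA A (C * (Y * Yᵀ)))

/-- Frobenius norm. -/
def frob {a c : ℕ} (M : Matrix (Fin a) (Fin c) ℝ) : ℝ := Real.sqrt (∑ i, ∑ j, (M i j) ^ 2)


/-- Linear independence of `A₁Y, …, AₘY` depends on `Y` only through `YYᵀ`. -/
theorem linearIndependent_mul_of_mul_transpose_eq {n m p q : ℕ}
    {A : Fin m → Matrix (Fin n) (Fin n) ℝ} {Y : Matrix (Fin n) (Fin p) ℝ}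
    {Z : Matrix (Fin n) (Fin q) ℝ} (h : Z * Zᵀ = Y * Yᵀ)
    (hZ : LinearIndependent ℝ (fun i => A i * Z)) :
    LinearIndependent ℝ (fun i => A i * Y) := by
  rw [Fintype.linearIndependent_iff] at hZ ⊢
  intro c hc
  refine hZ c ?_
  simp only [← Matrix.smul_mul, ← Matrix.sum_mul] at hc ⊢
  rw [← Matrix.mul_self_mul_conjTranspose_eq_zero, conjTranspose_eq_transpose_of_trivial] at hc ⊢
  rwa [h]

/-- Padding with zero columns does not change `YYᵀ`. -/
theorem exists_mul_transpose_eq_of_le {n p q : ℕ} (h : q ≤ p) (Y : Matrix (Fin n) (Fin q) ℝ) :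
    ∃ Z : Matrix (Fin n) (Fin p) ℝ, Z * Zᵀ = Y * Yᵀ := by
  let P : Matrix (Fin q) (Fin p) ℝ := (1 : Matrix (Fin p) (Fin p) ℝ).submatrix (Fin.castLE h) id
  have hP : P * Pᵀ = 1 := by
    simp only [P, transpose_submatrix, transpose_one]
    rw [← submatrix_mul _ _ _ _ _ Function.bijective_id, Matrix.mul_one,
      submatrix_one _ (Fin.castLE_injective h)]
  refine ⟨Y * P, ?_⟩
  rw [transpose_mul, Matrix.mul_assoc, ← Matrix.mul_assoc P, hP, Matrix.one_mul]

open scoped MatrixOrder Matrix.Norms.L2Operator in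
/-- Every matrix of the form `YYᵀ` has a square factor. -/
theorem exists_square_mul_transpose_eq {n q : ℕ} (Y : Matrix (Fin n) (Fin q) ℝ) :
    ∃ Z : Matrix (Fin n) (Fin n) ℝ, Z * Zᵀ = Y * Yᵀ := by
  have hY : (Y * Yᵀ).PosSemidef := by
    simpa using posSemidef_self_mul_conjTranspose Y
  obtain ⟨B, hB⟩ := CStarAlgebra.nonneg_iff_eq_star_mul_self.mp hY.nonneg
  exact ⟨Bᵀ, by simpa [star_eq_conjTranspose] using hB.symm⟩

/-- Proposition 2 of the paper: if the matrices A₁Y,…,AₘY are linearly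
independent for every Y ∈ ℳ_p, then the same holds for every 1 ≤ p' ≤ p with ℳ_{p'}
nonempty; and if it holds for p = n, it holds for every p' ≥ 1 with ℳ_{p'} nonempty. -/
theorem stmt0 (n m p : ℕ) (hn : 1 ≤ n) (hm : 1 ≤ m) (hp : 1 ≤ p)
    (A : Fin m → Matrix (Fin n) (Fin n) ℝ) (hA : ∀ i, (A i).IsSymm) (b : Fin m → ℝ) :
    ((∀ Y ∈ MM A b p, LinearIndependent ℝ (fun i => A i * Y)) →
      ∀ p' : ℕ, 1 ≤ p' → p' ≤ p → (MM A b p').Nonempty →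
        ∀ Y' ∈ MM A b p', LinearIndependent ℝ (fun i => A i * Y'))
    ∧
    ((∀ Y ∈ MM A b n, LinearIndependent ℝ (fun i => A i * Y)) →
      ∀ p' : ℕ, 1 ≤ p' → (MM A b p').Nonempty →
        ∀ Y' ∈ MM A b p', LinearIndependent ℝ (fun i => A i * Y')) := by
  have mem {q r : ℕ} {Y : Matrix (Fin n) (Fin q) ℝ} {Z : Matrix (Fin n) (Fin r) ℝ}
      (h : Z * Zᵀ = Y * Yᵀ) (hY : Y ∈ MM A b q) : Z ∈ MM A b r := by
    rw [MM, Set.mem_ofPred_eq] at hY ⊢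
    rwa [h]
  refine ⟨fun H p' _ hle _ Y hY => ?_, fun H p' _ _ Y hY => ?_⟩
  · obtain ⟨Z, hZ⟩ := exists_mul_transpose_eq_of_le hle Y
    exact linearIndependent_mul_of_mul_transpose_eq hZ (H Z (mem hZ hY))
  · obtain ⟨Z, hZ⟩ := exists_square_mul_transpose_eq Y
    exact linearIndependent_mul_of_mul_transpose_eq hZ (H Z (mem hZ hY))
end
end

section
/- Let Y ∈ ℝ^{n×p} have rank p and set X = YYᵀ, and assume X ∈ 𝒞. (i) If W ∈ Sym(n,ℝ) is such that X + W ∈ 𝒞 and X − tW ∈ 𝒞 for some t > 0, then there exists a symmetric matrix A ∈ Sym(p,ℝ) with 𝒜(Y A Yᵀ) = 0, I_p + A positive semidefinite, and X + W = Y (I_p + A) Yᵀ. (ii) Conversely, for every A ∈ Sym(p,ℝ) with 𝒜(Y A Yᵀ) = 0 and I_p + A positive semidefinite, the matrix X' = Y (I_p + A) Yᵀ belongs to 𝒞. -/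
open Matrix MeasureTheory

noncomputable section

/-- A matrix of full row rank over a field has a right inverse. -/
theorem exists_right_inverse_of_rank_eq_card {ι κ K : Type*} [Fintype ι] [Fintype κ]
    [DecidableEq ι] [Field K] (M : Matrix ι κ K) (hM : M.rank = Fintype.card ι) :
    ∃ R : Matrix κ ι K, M * R = 1 := by
  rw [← mulVec_surjective_iff_exists_right_inverse, ← coe_mulVecLin, ← LinearMap.range_eq_top]
  apply Submodule.eq_top_of_finrank_eq
  rw [Module.finrank_pi]
  exact hM

/-- If `X + W` and `X - t • W` are positive semidefinite for some `t > 0`, then `W` vanishes on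
the kernel of `X`. -/
theorem mulVec_eq_zero_of_posSemidef_add_sub {ι : Type*} [Fintype ι] {X W : Matrix ι ι ℝ} {t : ℝ}
    (ht : 0 < t) (hadd : (X + W).PosSemidef) (hsub : (X - t • W).PosSemidef) {v : ι → ℝ}
    (hv : X *ᵥ v = 0) : W *ᵥ v = 0 := by
  have hadd_nonneg := hadd.dotProduct_mulVec_nonneg v
  have hsub_nonneg := hsub.dotProduct_mulVec_nonneg v
  have hzero := hadd.dotProduct_mulVec_zero_iff v
  simp only [add_mulVec, sub_mulVec, smul_mulVec, hv, zero_add, zero_sub, dotProduct_neg,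
    dotProduct_smul, smul_eq_mul] at hadd_nonneg hsub_nonneg hzero
  exact hzero.1 (le_antisymm (by nlinarith) hadd_nonneg)

theorem calA_add {n m : ℕ} (A : Fin m → Matrix (Fin n) (Fin n) ℝ)
    (X Z : Matrix (Fin n) (Fin n) ℝ) : calA A (X + Z) = calA A X + calA A Z := by
  ext i
  simp [calA, Matrix.mul_add]

/-- Proposition 5 of the paper, description of the face of 𝒞 at X = YYᵀ
with Y of full rank p. -/
theorem stmt2 (n m p : ℕ) (hn : 1 ≤ n) (hm : 1 ≤ m)
    (A : Fin m → Matrix (Fin n) (Fin n) ℝ) (hA : ∀ i, (A i).IsSymm) (b : Fin m → ℝ)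
    (Y : Matrix (Fin n) (Fin p) ℝ) (hrk : Y.rank = p) (hX : Y * Yᵀ ∈ CC A b) :
    (∀ W : Matrix (Fin n) (Fin n) ℝ, W.IsSymm →
      Y * Yᵀ + W ∈ CC A b → (∃ t : ℝ, 0 < t ∧ Y * Yᵀ - t • W ∈ CC A b) →
      ∃ A' : Matrix (Fin p) (Fin p) ℝ, A'.IsSymm ∧ calA A (Y * A' * Yᵀ) = 0 ∧
        (1 + A').PosSemidef ∧ Y * Yᵀ + W = Y * (1 + A') * Yᵀ)
    ∧
    (∀ A' : Matrix (Fin p) (Fin p) ℝ, A'.IsSymm → calA A (Y * A' * Yᵀ) = 0 →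
      (1 + A').PosSemidef → Y * (1 + A') * Yᵀ ∈ CC A b) := by
  obtain ⟨-, hXb, -⟩ := hX
  refine ⟨?_, ?_⟩
  · rintro W hW ⟨-, hWb, hadd⟩ ⟨t, ht, -, -, hsub⟩
    obtain ⟨R, hR⟩ := exists_right_inverse_of_rank_eq_card Yᵀ (by simp [rank_transpose, hrk])
    have hR' : Rᵀ * Y = 1 := by simpa using congrArg transpose hR
    have hright : W * R * Yᵀ = W := by
      refine ext_of_mulVec_single fun i => ?_
      have h := mulVec_eq_zero_of_posSemidef_add_sub ht hadd hsub
        (v := (1 - R * Yᵀ) *ᵥ Pi.single i 1) (by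
          rw [mulVec_mulVec, Matrix.mul_assoc, Matrix.mul_sub, ← Matrix.mul_assoc Yᵀ, hR,
            Matrix.mul_one, Matrix.one_mul, sub_self, Matrix.mul_zero, zero_mulVec])
      rw [mulVec_mulVec, Matrix.mul_sub, sub_mulVec, sub_eq_zero, Matrix.mul_one] at h
      rw [Matrix.mul_assoc, ← h]
    have hleft : Y * Rᵀ * W = W := by
      simpa [hW.eq, Matrix.mul_assoc] using congrArg transpose hright
    have hface : Y * (Rᵀ * W * R) * Yᵀ = W := by
      rw [← Matrix.mul_assoc, ← Matrix.mul_assoc, hleft, hright]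
    refine ⟨Rᵀ * W * R, ?_, ?_, ?_, ?_⟩
    · simp [IsSymm, hW.eq, Matrix.mul_assoc]
    · rw [hface]
      rw [calA_add, hXb] at hWb
      exact add_eq_left.1 hWb
    · have h := hadd.conjTranspose_mul_mul_same R
      rwa [conjTranspose_eq_transpose_of_trivial, Matrix.mul_add, Matrix.add_mul,
        ← Matrix.mul_assoc, hR', Matrix.one_mul, hR] at h
    · rw [Matrix.mul_add, Matrix.add_mul, hface, Matrix.mul_one]
  · intro A' hA' hzero hpsd
    refine ⟨?_, ?_, ?_⟩
    · simp [IsSymm, hA'.eq, Matrix.mul_assoc]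
    · rw [Matrix.mul_add, Matrix.add_mul, Matrix.mul_one, calA_add, hXb, hzero, add_zero]
    · simpa using hpsd.mul_mul_conjTranspose_same Y
end
end

section
/- If X is an extreme point of the convex set 𝒞 (i.e., X ∈ 𝒞 and X does not lie in the relative interior of any nondegenerate line segment contained in 𝒞), then r(r+1)/2 ≤ m, where r = rank(X). -/
open Matrix MeasureTheory

noncomputable section

/-- A positive semidefinite real matrix of rank `r` factors as `Y * Yᵀ` with `Y` having `r` columns
and a left inverse. -/
theorem Matrix.PosSemidef.exists_eq_mul_transpose_of_rank {n : ℕ} {X : Matrix (Fin n) (Fin n) ℝ}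
    (hX : X.PosSemidef) :
    ∃ (Y : Matrix (Fin n) (Fin X.rank) ℝ) (L : Matrix (Fin X.rank) (Fin n) ℝ),
      L * Y = 1 ∧ X = Y * Yᵀ := by
  have hH := hX.isHermitian
  let ev := hH.eigenvalues
  let U : Matrix (Fin n) (Fin n) ℝ := hH.eigenvectorUnitary
  have hU : Uᵀ * U = 1 := by
    simpa [star_eq_conjTranspose] using Unitary.coe_star_mul_self hH.eigenvectorUnitary
  have hspec : X = U * diagonal ev * Uᵀ := by
    simpa [Unitary.conjStarAlgAut_apply, star_eq_conjTranspose, Function.comp_def] using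
      hH.spectral_theorem
  let e : Fin X.rank ≃ {i // ev i ≠ 0} := Fintype.equivOfCardEq (by
    rw [Fintype.card_fin]; exact hH.rank_eq_card_non_zero_eigs)
  have hpos (k : {i // ev i ≠ 0}) : 0 < √(ev k) :=
    Real.sqrt_pos.2 (lt_of_le_of_ne (hX.eigenvalues_nonneg k) k.2.symm)
  refine ⟨of fun i k => U i (e k) * √(ev (e k)), of fun k i => U i (e k) / √(ev (e k)), ?_, ?_⟩
  · ext k l
    have h : ∑ i, U i (e k) * U i (e l) = (1 : Matrix (Fin n) (Fin n) ℝ) (e k) (e l) := by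
      rw [← hU]; simp [mul_apply]
    calc _ = (∑ i, U i (e k) * U i (e l)) * (√(ev (e l)) / √(ev (e k))) := by
          simp only [mul_apply, of_apply, Finset.sum_mul]
          exact Finset.sum_congr rfl fun i _ => by ring
      _ = _ := by
          rw [h]
          obtain rfl | hkl := eq_or_ne k l
          · simp [(hpos (e k)).ne']
          · have : (e k : Fin n) ≠ e l := fun h => hkl (e.injective (Subtype.ext h))
            simp [one_apply_ne this, one_apply_ne hkl]
  · ext i j
    have h (k : {i // ev i ≠ 0}) :
        U i k * √(ev k) * (U j k * √(ev k)) = U i k * ev k * U j k := by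
      rw [mul_mul_mul_comm, Real.mul_self_sqrt (hX.eigenvalues_nonneg k)]; ring
    simp only [mul_apply, transpose_apply, of_apply]
    rw [e.sum_comp fun k => U i k * √(ev k) * (U j k * √(ev k)), Finset.sum_congr rfl fun k _ => h k]
    have hX' : X i j = ∑ k, U i k * ev k * U j k := by
      conv_lhs => rw [hspec]
      simp [mul_apply, diagonal_apply]
    rw [hX', ← Finset.sum_subtype (Finset.univ.filter fun k => ev k ≠ 0) (by simp)
      fun k => U i k * ev k * U j k]
    refine (Finset.sum_filter_of_ne fun k _ hk => ?_).symm
    contrapose! hk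
    simp [hk]

/-- Small symmetric perturbations of the identity are positive semidefinite. -/
theorem Matrix.IsSymm.exists_posSemidef_one_add_smul {ι : Type*} [Fintype ι] [DecidableEq ι]
    {S : Matrix ι ι ℝ} (hS : S.IsSymm) :
    ∃ ε : ℝ, 0 < ε ∧ (1 + ε • S).PosSemidef ∧ (1 - ε • S).PosSemidef := by
  set c := ∑ i, ∑ j, |S i j| with hc
  have hc0 : 0 ≤ c := by positivity
  have hquad (x : ι → ℝ) : |x ⬝ᵥ (S *ᵥ x)| ≤ c * (x ⬝ᵥ x) := by
    have hcoord (i : ι) : x i * x i ≤ x ⬝ᵥ x :=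
      Finset.single_le_sum (f := fun k => x k * x k) (fun k _ => mul_self_nonneg _)
        (Finset.mem_univ i)
    have hprod (i j : ι) : |x i * x j| ≤ x ⬝ᵥ x := by
      rw [abs_le]
      constructor <;> nlinarith [hcoord i, hcoord j, sq_nonneg (x i + x j), sq_nonneg (x i - x j)]
    calc |x ⬝ᵥ (S *ᵥ x)| = |∑ i, ∑ j, S i j * (x i * x j)| := by
          simp only [dotProduct, mulVec, Finset.mul_sum]
          congr 1
          exact Finset.sum_congr rfl fun i _ => Finset.sum_congr rfl fun j _ => by ring
      _ ≤ ∑ i, ∑ j, |S i j * (x i * x j)| :=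
          (Finset.abs_sum_le_sum_abs _ _).trans
            (Finset.sum_le_sum fun i _ => Finset.abs_sum_le_sum_abs _ _)
      _ ≤ ∑ i, ∑ j, |S i j| * (x ⬝ᵥ x) := by
          gcongr with i _ j _
          rw [abs_mul]
          gcongr
          exact hprod i j
      _ = c * (x ⬝ᵥ x) := by simp only [hc, Finset.sum_mul]
  have hε (x : ι → ℝ) : |(c + 1)⁻¹ * (x ⬝ᵥ (S *ᵥ x))| ≤ x ⬝ᵥ x := by
    have hx : 0 ≤ x ⬝ᵥ x := Finset.sum_nonneg fun k _ => mul_self_nonneg (x k)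
    rw [abs_mul, abs_of_pos (by positivity), inv_mul_le_iff₀ (by positivity)]
    linarith [hquad x]
  have hH : ((c + 1)⁻¹ • S).IsHermitian := by
    simp [IsHermitian, hS.eq]
  refine ⟨(c + 1)⁻¹, by positivity,
    .of_dotProduct_mulVec_nonneg (isHermitian_one.add hH) fun x => ?_,
    .of_dotProduct_mulVec_nonneg (isHermitian_one.sub hH) fun x => ?_⟩
  · simp only [star_trivial, add_mulVec, one_mulVec, smul_mulVec, dotProduct_add, dotProduct_smul,
      smul_eq_mul]
    linarith [(abs_le.1 (hε x)).1]
  · simp only [star_trivial, sub_mulVec, one_mulVec, smul_mulVec, dotProduct_sub, dotProduct_smul,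
      smul_eq_mul]
    linarith [(abs_le.1 (hε x)).2]

/-- The symmetric matrix with entries prescribed on unordered pairs. -/
def symMatrix (r : ℕ) : (Sym2 (Fin r) → ℝ) →ₗ[ℝ] Matrix (Fin r) (Fin r) ℝ where
  toFun f := of fun i j => f s(i, j)
  map_add' _ _ := rfl
  map_smul' _ _ := rfl

theorem isSymm_symMatrix {r : ℕ} (f : Sym2 (Fin r) → ℝ) : (symMatrix r f).IsSymm := by
  ext i j
  exact congrArg f Sym2.eq_swap

theorem symMatrix_injective (r : ℕ) : Function.Injective (symMatrix r) := by
  intro f g h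
  ext p
  induction p with
  | _ i j => exact congrFun (congrFun h i) j

/-- The constraint map as a linear map. -/
def calALinear {n m : ℕ} (A : Fin m → Matrix (Fin n) (Fin n) ℝ) :
    Matrix (Fin n) (Fin n) ℝ →ₗ[ℝ] (Fin m → ℝ) where
  toFun := calA A
  map_add' _ _ := by ext; simp [calA, Matrix.mul_add]
  map_smul' _ _ := by ext; simp [calA]

/-- The congruence `S ↦ Y * S * Yᵀ` as a linear map. -/
def congrLinear {n r : ℕ} (Y : Matrix (Fin n) (Fin r) ℝ) :
    Matrix (Fin r) (Fin r) ℝ →ₗ[ℝ] Matrix (Fin n) (Fin n) ℝ where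
  toFun S := Y * S * Yᵀ
  map_add' _ _ := by simp [Matrix.mul_add, Matrix.add_mul]
  map_smul' _ _ := by simp

/-- At an extreme point `Y * Yᵀ`, no nonzero symmetric `S` satisfies `𝒜(Y * S * Yᵀ) = 0`. -/
theorem eq_zero_of_extreme {n m r : ℕ} {A : Fin m → Matrix (Fin n) (Fin n) ℝ} {b : Fin m → ℝ}
    {X : Matrix (Fin n) (Fin n) ℝ} (hX : X ∈ CC A b)
    (hext : ∀ X₁ ∈ CC A b, ∀ X₂ ∈ CC A b, ∀ t : ℝ, 0 < t → t < 1 →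
      X = t • X₁ + (1 - t) • X₂ → X₁ = X₂)
    {Y : Matrix (Fin n) (Fin r) ℝ} {L : Matrix (Fin r) (Fin n) ℝ} (hL : L * Y = 1)
    (hXY : X = Y * Yᵀ) {S : Matrix (Fin r) (Fin r) ℝ} (hS : S.IsSymm)
    (hker : calA A (Y * S * Yᵀ) = 0) : S = 0 := by
  obtain ⟨ε, hε, hplus, hminus⟩ := hS.exists_posSemidef_one_add_smul
  have hb : calALinear A X = b := hX.2.1
  replace hker : calALinear A (Y * S * Yᵀ) = 0 := hker
  have hmem {P : Matrix (Fin n) (Fin n) ℝ} (hP : P.PosSemidef) (hPb : calALinear A P = b) :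
      P ∈ CC A b := ⟨by simpa [IsHermitian, IsSymm] using hP.isHermitian, hPb, hP⟩
  have h₁ : X + ε • (Y * S * Yᵀ) ∈ CC A b := by
    refine hmem ?_ (by simp [hb, hker])
    convert hplus.mul_mul_conjTranspose_same Y using 1
    simp [hXY, Matrix.mul_add, Matrix.add_mul]
  have h₂ : X - ε • (Y * S * Yᵀ) ∈ CC A b := by
    refine hmem ?_ (by simp [hb, hker])
    convert hminus.mul_mul_conjTranspose_same Y using 1
    simp [hXY, Matrix.mul_sub, Matrix.sub_mul]
  have heq := hext _ h₁ _ h₂ (1 / 2) (by norm_num) (by norm_num) (by module)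
  have hZ : Y * S * Yᵀ = 0 := by
    have h : (2 * ε) • (Y * S * Yᵀ) = 0 := by
      rw [← sub_eq_zero] at heq
      rw [← heq]
      module
    exact (smul_eq_zero.1 h).resolve_left (by positivity)
  have hL' : Yᵀ * Lᵀ = 1 := by rw [← transpose_mul, hL, transpose_one]
  calc S = (L * Y) * S * (Yᵀ * Lᵀ) := by simp [hL, hL']
    _ = L * (Y * S * Yᵀ) * Lᵀ := by simp only [Matrix.mul_assoc]
    _ = 0 := by simp [hZ]

/-- Pataki/Barvinok bound: an extreme point X of 𝒞 has
rank r with r(r+1)/2 ≤ m. -/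
theorem stmt3 (n m : ℕ) (hn : 1 ≤ n) (hm : 1 ≤ m)
    (A : Fin m → Matrix (Fin n) (Fin n) ℝ) (hA : ∀ i, (A i).IsSymm) (b : Fin m → ℝ)
    (X : Matrix (Fin n) (Fin n) ℝ) (hX : X ∈ CC A b)
    (hext : ∀ X₁ ∈ CC A b, ∀ X₂ ∈ CC A b, ∀ t : ℝ, 0 < t → t < 1 →
      X = t • X₁ + (1 - t) • X₂ → X₁ = X₂) :
    X.rank * (X.rank + 1) ≤ 2 * m := by
  obtain ⟨Y, L, hL, hXY⟩ := hX.2.2.exists_eq_mul_transpose_of_rank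
  have hinj : Function.Injective (calALinear A ∘ₗ congrLinear Y ∘ₗ symMatrix X.rank) := by
    rw [← LinearMap.ker_eq_bot, LinearMap.ker_eq_bot']
    intro f hf
    apply symMatrix_injective
    rw [map_zero]
    exact eq_zero_of_extreme hX hext hL hXY (isSymm_symMatrix f) hf
  have hdim := LinearMap.finrank_le_finrank_of_injective hinj
  rw [Module.finrank_pi, Module.finrank_pi, Sym2.card, Fintype.card_fin, Fintype.card_fin] at hdim
  rw [Nat.choose_two_right, Nat.add_sub_cancel] at hdim
  have heven := (Nat.even_mul_succ_self X.rank).two_dvd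
  rw [mul_comm (X.rank + 1)] at hdim
  lia
end
end

section
/- Let Y ∈ ℳ_p and assume the matrices A_1 Y, …, A_m Y are linearly independent. If S(Y) Y = 0 and S(Y) is positive semidefinite, then X = YYᵀ is globally optimal for the SDP (⟨C, YYᵀ⟩ ≤ ⟨C, X'⟩ for all X' ∈ 𝒞) and Y is globally optimal for the factorized problem (⟨C Y, Y⟩ ≤ ⟨C Y', Y'⟩ for all Y' ∈ ℳ_p). -/
open Matrix MeasureTheory

noncomputable section

open scoped MatrixOrder in
/-- The trace of a product of two positive semidefinite matrices is nonnegative. -/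
theorem trace_mul_nonneg_of_posSemidef {n : ℕ} {S X : Matrix (Fin n) (Fin n) ℝ}
    (hS : S.PosSemidef) (hX : X.PosSemidef) : 0 ≤ Matrix.trace (S * X) := by
  obtain ⟨Z, rfl⟩ := CStarAlgebra.nonneg_iff_eq_star_mul_self.mp hX.nonneg
  rw [Matrix.star_eq_conjTranspose, ← Matrix.mul_assoc, Matrix.trace_mul_comm, ← Matrix.mul_assoc]
  exact (hS.mul_mul_conjTranspose_same Z).trace_nonneg

/-- The map `adjA A` is adjoint to `calA A`. -/
theorem trace_adjA_mul {n m : ℕ} (A : Fin m → Matrix (Fin n) (Fin n) ℝ) (ν : Fin m → ℝ)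
    (X : Matrix (Fin n) (Fin n) ℝ) : Matrix.trace (adjA A ν * X) = ν ⬝ᵥ calA A X := by
  simp [adjA, calA, dotProduct, Matrix.sum_mul, Matrix.trace_sum]

/-- Weak duality: a dual certificate `C - adjA A ν ⪰ 0` annihilating `X` makes `X` optimal. -/
theorem trace_mul_le_of_dual_certificate {n m : ℕ} {A : Fin m → Matrix (Fin n) (Fin n) ℝ}
    {C X X' : Matrix (Fin n) (Fin n) ℝ} {ν : Fin m → ℝ} (hS : (C - adjA A ν).PosSemidef)
    (hSX : (C - adjA A ν) * X = 0) (hX' : X'.PosSemidef) (h : calA A X = calA A X') :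
    Matrix.trace (C * X) ≤ Matrix.trace (C * X') := by
  have h₁ := congrArg Matrix.trace hSX
  have h₂ := trace_mul_nonneg_of_posSemidef hS hX'
  rw [Matrix.sub_mul, Matrix.trace_sub, trace_adjA_mul] at h₁ h₂
  rw [h, Matrix.trace_zero] at h₁
  linarith

theorem ip_mul_self {n p : ℕ} {C : Matrix (Fin n) (Fin n) ℝ} (hC : C.IsSymm)
    (Y : Matrix (Fin n) (Fin p) ℝ) : ip (C * Y) Y = Matrix.trace (C * (Y * Yᵀ)) := by
  rw [ip, Matrix.transpose_mul, hC.eq, Matrix.mul_assoc, Matrix.trace_mul_comm, Matrix.mul_assoc]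

/-- Corollary 2 of the paper: if Y is a critical point (S(Y)Y = 0) and
S(Y) ⪰ 0, then X = YYᵀ is optimal for the SDP and Y is optimal for the factorized
problem. -/
theorem stmt5 (n m p : ℕ) (hn : 1 ≤ n) (hm : 1 ≤ m) (hp : 1 ≤ p)
    (A : Fin m → Matrix (Fin n) (Fin n) ℝ) (hA : ∀ i, (A i).IsSymm)
    (C : Matrix (Fin n) (Fin n) ℝ) (hC : C.IsSymm) (b : Fin m → ℝ)
    (Y : Matrix (Fin n) (Fin p) ℝ) (hY : Y ∈ MM A b p)
    (hli : LinearIndependent ℝ (fun i => A i * Y))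
    (hcrit : Smat A C Y * Y = 0) (hpsd : (Smat A C Y).PosSemidef) :
    (∀ X' ∈ CC A b, Matrix.trace (Cᵀ * (Y * Yᵀ)) ≤ Matrix.trace (Cᵀ * X')) ∧
    (∀ Y' ∈ MM A b p, ip (C * Y) Y ≤ ip (C * Y') Y') := by
  have hSX : Smat A C Y * (Y * Yᵀ) = 0 := by
    rw [← Matrix.mul_assoc, hcrit, Matrix.zero_mul]
  refine ⟨fun X' hX' => ?_, fun Y' hY' => ?_⟩
  · rw [hC.eq]
    exact trace_mul_le_of_dual_certificate hpsd hSX hX'.2.2 (hY.trans hX'.2.1.symm)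
  · rw [ip_mul_self hC, ip_mul_self hC]
    refine trace_mul_le_of_dual_certificate hpsd hSX ?_ (hY.trans hY'.symm)
    rw [← Matrix.conjTranspose_eq_transpose_of_trivial]
    exact Matrix.posSemidef_self_mul_conjTranspose Y'
end
end

section
/- Let Y ∈ ℳ_p with A_1 Y, …, A_m Y linearly independent, and suppose Y is a first-order critical point, i.e., S(Y) Y = 0. Then there exists ν ∈ ℝ^m such that rank(Y) + rank(C − 𝒜*(ν)) ≤ n; in particular rank(Y) is at most the maximal nullity of C − 𝒜*(ν) over ν ∈ ℝ^m. -/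
open Matrix MeasureTheory

noncomputable section

/-- first step of Lemma 3 of the paper: if Y ∈ ℳ_p is a first-order
critical point (S(Y)Y = 0), then there is ν ∈ ℝᵐ with
rank(Y) + rank(C − 𝒜*(ν)) ≤ n, i.e. rank(Y) is at most the nullity of C − 𝒜*(ν). -/
theorem stmt9 (n m p : ℕ) (hn : 1 ≤ n) (hm : 1 ≤ m) (hp : 1 ≤ p)
    (A : Fin m → Matrix (Fin n) (Fin n) ℝ) (hA : ∀ i, (A i).IsSymm)
    (C : Matrix (Fin n) (Fin n) ℝ) (hC : C.IsSymm) (b : Fin m → ℝ)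
    (Y : Matrix (Fin n) (Fin p) ℝ) (hY : Y ∈ MM A b p)
    (hli : LinearIndependent ℝ (fun i => A i * Y))
    (hcrit : Smat A C Y * Y = 0) :
    ∃ ν : Fin m → ℝ, Y.rank + (C - adjA A ν).rank ≤ n := by
  refine ⟨(gram A Y)⁻¹ *ᵥ calA A (C * (Y * Yᵀ)), ?_⟩
  simpa [Smat, add_comm] using rank_add_rank_le_card_of_mul_eq_zero hcrit
end
end

section
/- Suppose there exists X₀ ∈ 𝒞 with X₀ positive definite, and suppose trace(X) is the same for all X ∈ 𝒞. Then the identity matrix I_n lies in the range of 𝒜*, i.e., there exists ν ∈ ℝ^m with I_n = ν_1 A_1 + ⋯ + ν_m A_m. -/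
open Matrix MeasureTheory

noncomputable section

open scoped MatrixOrder in
/-- A Hermitian matrix becomes positive semidefinite after adding a large enough positive multiple
of the identity. -/
theorem Matrix.IsHermitian.exists_pos_posSemidef_add_smul_one {ι : Type*} [Fintype ι]
    [DecidableEq ι] {V : Matrix ι ι ℝ} (hV : V.IsHermitian) :
    ∃ M : ℝ, 0 < M ∧ (V + M • (1 : Matrix ι ι ℝ)).PosSemidef := by
  obtain ⟨c, hc⟩ := (Set.finite_range hV.eigenvalues).bddBelow
  have hle : algebraMap ℝ (Matrix ι ι ℝ) (-(|c| + 1)) ≤ V := by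
    refine algebraMap_le_of_le_spectrum (fun x hx => ?_) hV.isSelfAdjoint
    rw [hV.spectrum_real_eq_range_eigenvalues] at hx
    linarith [hc hx, neg_abs_le c]
  refine ⟨|c| + 1, by positivity, ?_⟩
  rw [Matrix.le_iff, Algebra.algebraMap_eq_smul_one, neg_smul, sub_neg_eq_add] at hle
  exact hle

open scoped MatrixOrder in
/-- A positive definite matrix dominates a positive multiple of the identity. -/
theorem Matrix.PosDef.exists_pos_posSemidef_sub_smul_one {ι : Type*} [Fintype ι]
    [DecidableEq ι] {X : Matrix ι ι ℝ} (hX : X.PosDef) :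
    ∃ ε : ℝ, 0 < ε ∧ (X - ε • (1 : Matrix ι ι ℝ)).PosSemidef := by
  cases isEmpty_or_nonempty ι with
  | inl h => exact ⟨1, one_pos, by rw [Subsingleton.elim (X - _) 0]; exact .zero⟩
  | inr h =>
    obtain ⟨ε, hε, hle⟩ := (CFC.exists_pos_algebraMap_le_iff hX.isHermitian.isSelfAdjoint).2
      fun x hx => by
        obtain ⟨i, rfl⟩ := hX.isHermitian.spectrum_real_eq_range_eigenvalues ▸ hx
        exact hX.eigenvalues_pos i
    rw [Matrix.le_iff, Algebra.algebraMap_eq_smul_one] at hle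
    exact ⟨ε, hε, hle⟩

/-- A positive definite matrix stays positive semidefinite under a small perturbation in a
Hermitian direction. -/
theorem Matrix.PosDef.exists_pos_posSemidef_add_smul {ι : Type*} [Fintype ι]
    [DecidableEq ι] {X V : Matrix ι ι ℝ} (hX : X.PosDef) (hV : V.IsHermitian) :
    ∃ t : ℝ, 0 < t ∧ (X + t • V).PosSemidef := by
  obtain ⟨M, hM, hVM⟩ := hV.exists_pos_posSemidef_add_smul_one
  obtain ⟨ε, hε, hXε⟩ := hX.exists_pos_posSemidef_sub_smul_one
  refine ⟨ε / M, by positivity, ?_⟩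
  have h := hXε.add (hVM.smul (show 0 ≤ ε / M by positivity))
  rwa [smul_add, smul_smul, div_mul_cancel₀ _ hM.ne', sub_add_add_cancel] at h

/-- If `trace (B * V) = 0` whenever `trace (A i * V) = 0` for all `i`, then `B` is a linear
combination of the matrices `A i`. -/
theorem Matrix.exists_eq_sum_smul_of_trace_mul_eq_zero {ι κ : Type*} [Fintype ι] [Fintype κ]
    {A : κ → Matrix ι ι ℝ} {B : Matrix ι ι ℝ}
    (h : ∀ V : Matrix ι ι ℝ, (∀ i, trace (A i * V) = 0) → trace (B * V) = 0) :
    ∃ ν : κ → ℝ, B = ∑ i, ν i • A i := by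
  let L : Matrix ι ι ℝ → Matrix ι ι ℝ →ₗ[ℝ] ℝ :=
    fun C => traceLinearMap ι ℝ ℝ ∘ₗ LinearMap.mulLeft ℝ C
  have hmem : L B ∈ Submodule.span ℝ (Set.range fun i => L (A i)) := by
    refine mem_span_of_iInf_ker_le_ker fun V hV => ?_
    simp only [Submodule.mem_iInf, LinearMap.mem_ker] at hV
    exact h V hV
  obtain ⟨ν, hν⟩ := (Submodule.mem_span_range_iff_exists_fun ℝ).1 hmem
  refine ⟨ν, Matrix.ext_iff_trace_mul_right.2 fun V => ?_⟩
  have := LinearMap.congr_fun hν V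
  simpa [L, Finset.sum_mul, trace_sum] using this.symm

/-- end of the proof of Lemma 4 of the paper: if 𝒞 contains a positive
definite matrix (Slater point) and all members of 𝒞 have the same trace, then the
identity matrix lies in the range of 𝒜*. -/
theorem stmt14 (n m : ℕ) (hn : 1 ≤ n) (hm : 1 ≤ m)
    (A : Fin m → Matrix (Fin n) (Fin n) ℝ) (hA : ∀ i, (A i).IsSymm) (b : Fin m → ℝ)
    (X₀ : Matrix (Fin n) (Fin n) ℝ) (hX₀ : X₀ ∈ CC A b) (hpd : X₀.PosDef)
    (htr : ∀ X ∈ CC A b, ∀ X' ∈ CC A b, Matrix.trace X = Matrix.trace X') :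
    ∃ ν : Fin m → ℝ, (1 : Matrix (Fin n) (Fin n) ℝ) = ∑ i, ν i • A i := by
  refine exists_eq_sum_smul_of_trace_mul_eq_zero fun V hV => ?_
  have hsymm : (V + Vᵀ).IsSymm := isSymm_add_transpose_self V
  have hAV (i : Fin m) : trace (A i * (V + Vᵀ)) = 0 := by
    have hT : trace (A i * Vᵀ) = trace (A i * V) := by
      rw [← trace_transpose, transpose_mul, transpose_transpose, (hA i).eq, trace_mul_comm]
    rw [mul_add, trace_add, hT, hV i, add_zero]
  obtain ⟨t, ht, hpsd⟩ := hpd.exists_pos_posSemidef_add_smul (V := V + Vᵀ)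
    (by rw [IsHermitian, conjTranspose_eq_transpose_of_trivial, hsymm.eq])
  have hmem : X₀ + t • (V + Vᵀ) ∈ CC A b := by
    refine ⟨hX₀.1.add (hsymm.smul t), ?_, hpsd⟩
    rw [← hX₀.2.1]
    ext i
    simp only [calA, Matrix.mul_add (A i) X₀, Matrix.mul_smul, trace_add, trace_smul, hAV,
      smul_zero, add_zero]
  have htrace := htr _ hmem _ hX₀
  rw [trace_add, trace_smul, trace_add, trace_transpose, smul_eq_mul, add_eq_left,
    mul_eq_zero_iff_left ht.ne'] at htrace
  rw [one_mul]
  linarith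
end
end

section
/- Let Y ∈ ℳ_p with A_1 Y, …, A_m Y linearly independent and rank(Y) < p. If for some ε_H ≥ 0 one has 2⟨Ẏ, S(Y) Ẏ⟩ ≥ −ε_H ‖Ẏ‖² for every Ẏ ∈ ℝ^{n×p} with ⟨A_i Y, Ẏ⟩ = 0 for all i, then S(Y) + (ε_H/2) I_n is positive semidefinite. -/
open Matrix MeasureTheory

noncomputable section

theorem exists_ne_zero_mulVec_eq_zero_of_rank_lt {n p : ℕ} (Y : Matrix (Fin n) (Fin p) ℝ)
    (h : Y.rank < p) : ∃ z : Fin p → ℝ, z ≠ 0 ∧ Y *ᵥ z = 0 := by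
  by_contra! hz
  have hker : LinearMap.ker Y.mulVecLin = ⊥ :=
    LinearMap.ker_eq_bot'.2 fun z hYz => by_contra fun hne => hz z hne hYz
  have hdim := Y.mulVecLin.finrank_range_add_finrank_ker
  rw [hker, finrank_bot, Module.finrank_fin_fun] at hdim
  exact h.ne hdim

theorem ip_vecMulVec_right {n p : ℕ} (M : Matrix (Fin n) (Fin p) ℝ) (x : Fin n → ℝ)
    (z : Fin p → ℝ) : ip M (vecMulVec x z) = x ⬝ᵥ (M *ᵥ z) := by
  rw [ip, mul_vecMulVec, trace_vecMulVec, mulVec_transpose, dotProduct_mulVec]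

theorem ip_vecMulVec_mul_vecMulVec {n p : ℕ} (S : Matrix (Fin n) (Fin n) ℝ) (x : Fin n → ℝ)
    (z : Fin p → ℝ) :
    ip (vecMulVec x z) (S * vecMulVec x z) = (z ⬝ᵥ z) * (x ⬝ᵥ (S *ᵥ x)) := by
  rw [mul_vecMulVec, ip_vecMulVec_right, vecMulVec_mulVec, op_smul_eq_smul, dotProduct_smul,
    smul_eq_mul, dotProduct_comm x]

theorem frob_vecMulVec_sq {n p : ℕ} (x : Fin n → ℝ) (z : Fin p → ℝ) :
    frob (vecMulVec x z) ^ 2 = (z ⬝ᵥ z) * (x ⬝ᵥ x) := by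
  rw [frob, Real.sq_sqrt (by positivity), mul_comm]
  simp only [vecMulVec_apply, dotProduct, Finset.sum_mul_sum]
  exact Finset.sum_congr rfl fun i _ => Finset.sum_congr rfl fun j _ => by ring

theorem Smat_isSymm {n m p : ℕ} {A : Fin m → Matrix (Fin n) (Fin n) ℝ}
    (hA : ∀ i, (A i).IsSymm) {C : Matrix (Fin n) (Fin n) ℝ} (hC : C.IsSymm)
    (Y : Matrix (Fin n) (Fin p) ℝ) : (Smat A C Y).IsSymm := by
  simp only [Matrix.IsSymm, Smat, adjA, transpose_sub, transpose_sum, transpose_smul, hC.eq,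
    (hA _).eq]

/-- Lemma 5 of the paper: if Y is column-rank deficient and the
(Riemannian) Hessian condition 2⟨Ẏ, S(Y)Ẏ⟩ ≥ −ε_H ‖Ẏ‖² holds on the tangent space,
then S(Y) + (ε_H/2) Iₙ ⪰ 0. -/
theorem stmt15 (n m p : ℕ) (hn : 1 ≤ n) (hm : 1 ≤ m) (hp : 1 ≤ p)
    (A : Fin m → Matrix (Fin n) (Fin n) ℝ) (hA : ∀ i, (A i).IsSymm)
    (C : Matrix (Fin n) (Fin n) ℝ) (hC : C.IsSymm) (b : Fin m → ℝ)
    (Y : Matrix (Fin n) (Fin p) ℝ) (hY : Y ∈ MM A b p)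
    (hli : LinearIndependent ℝ (fun i => A i * Y))
    (hrk : Y.rank < p) (εH : ℝ) (hεH : 0 ≤ εH)
    (hhess : ∀ V : Matrix (Fin n) (Fin p) ℝ, (∀ i, ip (A i * Y) V = 0) →
      -εH * frob V ^ 2 ≤ 2 * ip V (Smat A C Y * V)) :
    (Smat A C Y + (εH / 2) • (1 : Matrix (Fin n) (Fin n) ℝ)).PosSemidef := by
  obtain ⟨z, hz, hYz⟩ := exists_ne_zero_mulVec_eq_zero_of_rank_lt Y hrk
  have hzz : 0 < z ⬝ᵥ z := by simpa using dotProduct_star_self_pos_iff.2 hz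
  refine .of_dotProduct_mulVec_nonneg ?_ fun x => ?_
  · rw [IsHermitian, conjTranspose_eq_transpose_of_trivial]
    exact (Smat_isSymm hA hC Y).add (isSymm_one.smul _)
  · have h := hhess (vecMulVec x z) fun i => by
      rw [ip_vecMulVec_right, ← mulVec_mulVec, hYz, mulVec_zero, dotProduct_zero]
    rw [ip_vecMulVec_mul_vecMulVec, frob_vecMulVec_sq] at h
    rw [star_trivial, add_mulVec, smul_mulVec, one_mulVec, dotProduct_add, dotProduct_smul,
      smul_eq_mul]
    refine nonneg_of_mul_nonneg_right ?_ hzz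
    linarith
end
end

section
/- Let C, B ∈ Sym(n,ℝ) with B positive definite, and let x ∈ ℝⁿ satisfy xᵀ B x = 1. Suppose x satisfies the first- and second-order necessary optimality conditions for minimizing xᵀ C x over {x : xᵀ B x = 1}: there exists λ ∈ ℝ with C x = λ B x, and for every v ∈ ℝⁿ with vᵀ B x = 0 one has vᵀ (C − λ B) v ≥ 0. Then x is a global minimizer: xᵀ C x ≤ yᵀ C y for every y ∈ ℝⁿ with yᵀ B y = 1. -/
open Matrix

noncomputable section

/-- A symmetric matrix annihilating `x` has a quadratic form invariant under translation by
multiples of `x`. -/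
theorem Matrix.IsSymm.dotProduct_mulVec_sub_smul {R ι : Type*} [CommRing R] [Fintype ι]
    {M : Matrix ι ι R} (hM : M.IsSymm) {x : ι → R} (hx : M *ᵥ x = 0) (y : ι → R) (c : R) :
    (y - c • x) ⬝ᵥ (M *ᵥ (y - c • x)) = y ⬝ᵥ (M *ᵥ y) := by
  have hxM : x ⬝ᵥ (M *ᵥ y) = 0 := by
    rw [dotProduct_mulVec, ← mulVec_transpose, hM.eq, hx, zero_dotProduct]
  simp [mulVec_sub, mulVec_smul, hx, sub_dotProduct, hxM]

/-- Corollary 6 of the paper: for the generalized eigenvalue problem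
min xᵀCx s.t. xᵀBx = 1 with B ≻ 0, every second-order critical point is a global
minimizer. -/
theorem stmt17 (n : ℕ) (hn : 2 ≤ n)
    (C B : Matrix (Fin n) (Fin n) ℝ) (hC : C.IsSymm) (hB : B.PosDef)
    (x : Fin n → ℝ) (hx : x ⬝ᵥ (B *ᵥ x) = 1)
    (hcrit : ∃ l : ℝ, C *ᵥ x = l • (B *ᵥ x) ∧
      ∀ v : Fin n → ℝ, v ⬝ᵥ (B *ᵥ x) = 0 → 0 ≤ v ⬝ᵥ ((C - l • B) *ᵥ v)) :
    ∀ y : Fin n → ℝ, y ⬝ᵥ (B *ᵥ y) = 1 → x ⬝ᵥ (C *ᵥ x) ≤ y ⬝ᵥ (C *ᵥ y) := by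
  obtain ⟨l, hl, hpos⟩ := hcrit
  intro y hy
  have hBsymm : B.IsSymm := isHermitian_iff_isSymm.mp hB.isHermitian
  have hker : (C - l • B) *ᵥ x = 0 := by rw [sub_mulVec, smul_mulVec, hl, sub_self]
  have h := hpos (y - (y ⬝ᵥ (B *ᵥ x)) • x) (by simp [sub_dotProduct, hx])
  rw [(hC.sub (hBsymm.smul l)).dotProduct_mulVec_sub_smul hker, sub_mulVec, smul_mulVec,
    dotProduct_sub, dotProduct_smul, hy, smul_eq_mul, mul_one, sub_nonneg] at h
  rwa [hl, dotProduct_smul, hx, smul_eq_mul, mul_one]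
end
end

section
/- Let d, q, p ≥ 1 be integers with n = qd and d ≤ p ≤ n. Let Y ∈ ℝ^{n×p} have rank p, and partition its rows into q consecutive blocks Z₁, …, Z_q ∈ ℝ^{d×p}, assuming each block has orthonormal rows: Z_k Z_kᵀ = I_d for all k. Let V = {A ∈ Sym(p,ℝ) : Z_k A Z_kᵀ = 0 for k = 1,…,q}. Then p(p+1)/2 − n(d+1)/2 ≤ dim V ≤ p(p+1)/2 − p(d+1)/2. Moreover, if p is an integer multiple of d, there exists such a Y for which the upper bound is attained. -/
open Matrix

noncomputable section

/-- The k-th block of d rows of Y (rows indexed by Fin q × Fin d). -/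
def Zblock {d q p : ℕ} (Y : Matrix (Fin q × Fin d) (Fin p) ℝ) (k : Fin q) :
    Matrix (Fin d) (Fin p) ℝ := Matrix.of fun a j => Y (k, a) j

/-- The subspace V = {A ∈ Sym(p,ℝ) : Z_k A Z_kᵀ = 0 for all k}. -/
def ocSpace {d q p : ℕ} (Y : Matrix (Fin q × Fin d) (Fin p) ℝ) :
    Submodule ℝ (Matrix (Fin p) (Fin p) ℝ) where
  carrier := {B | B.IsSymm ∧ ∀ k : Fin q, Zblock Y k * B * (Zblock Y k)ᵀ = 0}
  add_mem' := by
    rintro B C ⟨hB1, hB2⟩ ⟨hC1, hC2⟩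
    refine ⟨?_, fun k => ?_⟩
    · simp [Matrix.IsSymm, Matrix.transpose_add, hB1.eq, hC1.eq]
    · simp [Matrix.mul_add, Matrix.add_mul, hB2 k, hC2 k]
  zero_mem' := by
    refine ⟨?_, fun k => ?_⟩ <;> simp [Matrix.IsSymm]
  smul_mem' := by
    rintro r B ⟨hB1, hB2⟩
    refine ⟨?_, fun k => ?_⟩
    · simp [Matrix.IsSymm, Matrix.transpose_smul, hB1.eq]
    · simp [Matrix.mul_smul, Matrix.smul_mul, hB2 k]

/-- The bilinear forms in `G` that vanish on `W × W`. -/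
def vanishingOn {E : Type*} [AddCommGroup E] [Module ℝ E]
    (G : Submodule ℝ (LinearMap.BilinForm ℝ E)) (W : Submodule ℝ E) :
    Submodule ℝ (LinearMap.BilinForm ℝ E) where
  carrier := {B | B ∈ G ∧ ∀ u ∈ W, ∀ v ∈ W, B u v = 0}
  add_mem' := by
    rintro B C ⟨hB, hB'⟩ ⟨hC, hC'⟩
    exact ⟨G.add_mem hB hC, fun u hu v hv => by simp [hB' u hu v hv, hC' u hu v hv]⟩
  zero_mem' := ⟨G.zero_mem, by simp⟩
  smul_mem' := by
    rintro r B ⟨hB, hB'⟩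
    exact ⟨G.smul_mem r hB, fun u hu v hv => by simp [hB' u hu v hv]⟩

/-- Passing from forms vanishing on `W` to forms vanishing on `W ⊔ U` costs at most
`(dim (W ⊔ U) - dim W) * (dim (W ⊔ U) - dim U)` dimensions if the forms already vanish on `U`. -/
lemma finrank_vanishingOn_le {E : Type*} [AddCommGroup E] [Module ℝ E] [FiniteDimensional ℝ E]
    (G : Submodule ℝ (LinearMap.BilinForm ℝ E)) (W U : Submodule ℝ E)
    (hsymm : ∀ B ∈ G, ∀ u v, B u v = B v u)
    (hU : ∀ B ∈ G, ∀ u ∈ U, ∀ v ∈ U, B u v = 0) :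
    ∃ r c : ℕ, Module.finrank ℝ (W ⊔ U : Submodule ℝ E) = Module.finrank ℝ W + r ∧
      Module.finrank ℝ (W ⊔ U : Submodule ℝ E) = Module.finrank ℝ U + c ∧
      r ≤ Module.finrank ℝ U ∧
      Module.finrank ℝ (vanishingOn G W) ≤
        Module.finrank ℝ (vanishingOn G (W ⊔ U)) + r * c := by
  obtain ⟨C, hC⟩ := Submodule.exists_isCompl ((W ⊓ U).comap U.subtype)
  obtain ⟨D, hD⟩ := Submodule.exists_isCompl (U.comap (W ⊔ U).subtype)
  have hrU := Submodule.finrank_add_eq_of_isCompl hC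
  have hrD := Submodule.finrank_add_eq_of_isCompl hD
  have h1 : Module.finrank ℝ ((W ⊓ U).comap U.subtype) =
      Module.finrank ℝ (W ⊓ U : Submodule ℝ E) :=
    (Submodule.comapSubtypeEquivOfLe inf_le_right).finrank_eq
  have h2 : Module.finrank ℝ (U.comap (W ⊔ U).subtype) = Module.finrank ℝ U :=
    (Submodule.comapSubtypeEquivOfLe le_sup_right).finrank_eq
  have h3 := Submodule.finrank_sup_add_finrank_inf_eq W U
  refine ⟨Module.finrank ℝ C, Module.finrank ℝ D, by omega, by omega, by omega, ?_⟩
  let i : C →ₗ[ℝ] E := U.subtype ∘ₗ C.subtype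
  let j : D →ₗ[ℝ] E := (W ⊔ U).subtype ∘ₗ D.subtype
  let Φ : vanishingOn G W →ₗ[ℝ] (C →ₗ[ℝ] D →ₗ[ℝ] ℝ) :=
    { toFun := fun B => (B : LinearMap.BilinForm ℝ E).compl₁₂ i j
      map_add' := fun B B' => by ext; simp
      map_smul' := fun r B => by ext; simp }
  let _ : AddCommGroup (LinearMap.BilinForm ℝ E) := LinearMap.addCommGroup
  let _ : AddCommGroup (vanishingOn G W) := Submodule.addCommGroup (vanishingOn G W)
  have hrank := LinearMap.finrank_range_add_finrank_ker (K := ℝ) (V := vanishingOn G W)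
    (V₂ := C →ₗ[ℝ] D →ₗ[ℝ] ℝ) Φ
  have hr : Module.finrank ℝ (LinearMap.range Φ) ≤ Module.finrank ℝ C * Module.finrank ℝ D := by
    refine (Submodule.finrank_le _).trans ?_
    simp [Module.finrank_linearMap]
  have hk : Module.finrank ℝ (LinearMap.ker Φ) ≤ Module.finrank ℝ (vanishingOn G (W ⊔ U)) := by
    have hmap : (LinearMap.ker Φ).map (vanishingOn G W).subtype ≤ vanishingOn G (W ⊔ U) := by
      rintro _ ⟨B, hB, rfl⟩
      have hBG : (B : LinearMap.BilinForm ℝ E) ∈ G := B.2.1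
      have hCD : ∀ (c : C) (e : D), (B : LinearMap.BilinForm ℝ E) (i c) (j e) = 0 := fun c e => by
        have := LinearMap.congr_fun (LinearMap.congr_fun (LinearMap.mem_ker.1 hB) c) e
        simpa [Φ] using this
      have hCW : ∀ (c : C), ∀ v ∈ W ⊔ U, (B : LinearMap.BilinForm ℝ E) (i c) v = 0 := by
        intro c v hv
        have hm : (⟨v, hv⟩ : (W ⊔ U : Submodule ℝ E)) ∈ U.comap (W ⊔ U).subtype ⊔ D := by
          rw [hD.sup_eq_top]; trivial
        obtain ⟨x, hx, y, hy, hxy⟩ := Submodule.mem_sup.1 hm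
        have hv' : v = (x : E) + j ⟨y, hy⟩ := congrArg Subtype.val hxy.symm
        rw [hv', map_add, hCD, add_zero]
        exact hU _ hBG _ (c : U).2 _ hx
      have hdec : ∀ v ∈ W ⊔ U, ∃ w ∈ W, ∃ c : C, v = w + i c := by
        intro v hv
        obtain ⟨w, hw, u, hu, rfl⟩ := Submodule.mem_sup.1 hv
        have hm : (⟨u, hu⟩ : U) ∈ (W ⊓ U).comap U.subtype ⊔ C := by
          rw [hC.sup_eq_top]; trivial
        obtain ⟨x, hx, y, hy, hxy⟩ := Submodule.mem_sup.1 hm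
        have hu' : u = (x : E) + i ⟨y, hy⟩ := congrArg Subtype.val hxy.symm
        exact ⟨w + x, W.add_mem hw hx.1, ⟨y, hy⟩, by rw [hu', add_assoc]⟩
      refine ⟨hBG, fun u hu v hv => ?_⟩
      obtain ⟨w, hw, c, rfl⟩ := hdec u hu
      obtain ⟨w', hw', c', rfl⟩ := hdec v hv
      simp only [Submodule.subtype_apply]
      rw [LinearMap.map_add₂, hCW c _ hv, add_zero, map_add, B.2.2 w hw w' hw', zero_add,
        hsymm _ hBG, hCW c' w (Submodule.mem_sup_left hw)]
    rw [← Submodule.finrank_map_subtype_eq]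
    exact Submodule.finrank_mono hmap
  omega

/-- A space of symmetric bilinear forms on `E` vanishing on `d`-dimensional subspaces that
together span `E` has dimension at most `dim E * (dim E - d) / 2`. -/
lemma two_mul_finrank_le_of_vanishing {ι E : Type*} [Fintype ι] [AddCommGroup E] [Module ℝ E]
    [FiniteDimensional ℝ E] {d : ℕ} (G : Submodule ℝ (LinearMap.BilinForm ℝ E))
    (U : ι → Submodule ℝ E) (hsymm : ∀ B ∈ G, ∀ u v, B u v = B v u)
    (hU : ∀ k, ∀ B ∈ G, ∀ u ∈ U k, ∀ v ∈ U k, B u v = 0)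
    (hd : ∀ k, Module.finrank ℝ (U k) = d) (htop : ⨆ k, U k = ⊤) :
    2 * Module.finrank ℝ G + Module.finrank ℝ E * d ≤
      Module.finrank ℝ E * Module.finrank ℝ E := by
  classical
  have key : ∀ s : Finset ι,
      2 * Module.finrank ℝ G + Module.finrank ℝ (s.sup U : Submodule ℝ E) * d ≤
        2 * Module.finrank ℝ (vanishingOn G (s.sup U)) +
          Module.finrank ℝ (s.sup U : Submodule ℝ E) *
            Module.finrank ℝ (s.sup U : Submodule ℝ E) := by
    intro s
    induction s using Finset.induction_on with
    | empty =>
      have : vanishingOn G ⊥ = G := by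
        ext B
        simp [vanishingOn]
      rw [Finset.sup_empty, this, finrank_bot]
      omega
    | insert k s _ ih =>
      obtain ⟨r, c, h1, h2, h3, h4⟩ :=
        finrank_vanishingOn_le G (s.sup U) (U k) hsymm (hU k)
      rw [Finset.sup_insert, sup_comm]
      rw [hd] at h2 h3
      set w := Module.finrank ℝ (s.sup U : Submodule ℝ E)
      set w' := Module.finrank ℝ (s.sup U ⊔ U k : Submodule ℝ E)
      zify at *
      have hc : (c : ℤ) = w + r - d := by linarith
      rw [h1]
      rw [hc] at h4
      nlinarith [mul_nonneg (Int.natCast_nonneg r) (sub_nonneg.2 h3)]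
  have h := key Finset.univ
  rw [Finset.sup_univ_eq_iSup, htop, finrank_top] at h
  have hbot : vanishingOn G ⊤ = ⊥ := by
    rw [eq_bot_iff]
    rintro B ⟨-, hB⟩
    rw [Submodule.mem_bot]
    ext u v
    exact hB u trivial v trivial
  rw [hbot, finrank_bot] at h
  omega

/-- The space of symmetric real matrices. -/
def symmMatrices (n : ℕ) : Submodule ℝ (Matrix (Fin n) (Fin n) ℝ) where
  carrier := {A | A.IsSymm}
  add_mem' := fun hA hB => Matrix.IsSymm.add hA hB
  zero_mem' := Matrix.isSymm_zero
  smul_mem' := fun r _ hA => Matrix.IsSymm.smul hA r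

lemma two_mul_finrank_symmMatrices (n : ℕ) :
    2 * Module.finrank ℝ (symmMatrices n) = n * (n + 1) := by
  let e : symmMatrices n ≃ₗ[ℝ] (Sym2 (Fin n) → ℝ) :=
    { toFun := fun A => Sym2.lift ⟨fun i j => A.1 i j, fun i j => (A.2.apply i j).symm⟩
      invFun := fun f => ⟨Matrix.of fun i j => f s(i, j), by
        ext i j
        simp [Sym2.eq_swap]⟩
      map_add' := fun A B => by
        ext s
        induction s using Sym2.ind
        simp
      map_smul' := fun r A => by
        ext s
        induction s using Sym2.ind
        simp
      left_inv := fun A => by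
        ext i j
        simp
      right_inv := fun f => by
        ext s
        induction s using Sym2.ind
        simp }
  rw [e.finrank_eq, Module.finrank_fintype_fun_eq_card, Sym2.card, Fintype.card_fin,
    Nat.choose_two_right, Nat.add_sub_cancel, Nat.mul_div_cancel' , mul_comm]
  exact (Nat.even_mul_pred_self (n + 1)).two_dvd

lemma le_two_mul_finrank_ocSpace {d q p : ℕ} (Y : Matrix (Fin q × Fin d) (Fin p) ℝ) :
    p * (p + 1) ≤ 2 * Module.finrank ℝ (ocSpace Y) + (q * d) * (d + 1) := by
  let Φ : symmMatrices p →ₗ[ℝ] (Fin q → symmMatrices d) :=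
    { toFun := fun A k => ⟨Zblock Y k * A.1 * (Zblock Y k)ᵀ, by
        have hA : A.1ᵀ = A.1 := A.2
        change _ᵀ = _
        simp [Matrix.transpose_mul, hA, Matrix.mul_assoc]⟩
      map_add' := fun A B => by
        ext k : 2
        simp [Matrix.mul_add, Matrix.add_mul]
      map_smul' := fun r A => by
        ext k : 2
        simp }
  have hrank := Φ.finrank_range_add_finrank_ker
  have hr : Module.finrank ℝ (LinearMap.range Φ) ≤ q * Module.finrank ℝ (symmMatrices d) := by
    refine (Submodule.finrank_le _).trans ?_
    simp [Module.finrank_pi_fintype]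
  have hk : Module.finrank ℝ (LinearMap.ker Φ) ≤ Module.finrank ℝ (ocSpace Y) := by
    have hmap : (LinearMap.ker Φ).map (symmMatrices p).subtype ≤ ocSpace Y := by
      rintro _ ⟨A, hA, rfl⟩
      exact ⟨A.2, fun k => congrArg Subtype.val (congrFun (LinearMap.mem_ker.1 hA) k)⟩
    rw [← Submodule.finrank_map_subtype_eq]
    exact Submodule.finrank_mono hmap
  have hp := two_mul_finrank_symmMatrices p
  have hd := two_mul_finrank_symmMatrices d
  have : 2 * (q * Module.finrank ℝ (symmMatrices d)) = q * d * (d + 1) := by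
    rw [mul_assoc, ← hd]; ring
  omega

lemma two_mul_finrank_ocSpace_le {d q p : ℕ} (Y : Matrix (Fin q × Fin d) (Fin p) ℝ)
    (hrk : Y.rank = p) (horth : ∀ k : Fin q, Zblock Y k * (Zblock Y k)ᵀ = 1) :
    2 * Module.finrank ℝ (ocSpace Y) + p * (d + 1) ≤ p * (p + 1) := by
  have hrow : ∀ k, Module.finrank ℝ (Submodule.span ℝ (Set.range (Zblock Y k).row)) = d := by
    intro k
    rw [← Matrix.rank_eq_finrank_span_row]
    refine le_antisymm (by simpa using (Zblock Y k).rank_le_card_height) ?_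
    have := Matrix.rank_mul_le_left (Zblock Y k) (Zblock Y k)ᵀ
    rwa [horth, Matrix.rank_one, Fintype.card_fin] at this
  have htop : ⨆ k, Submodule.span ℝ (Set.range (Zblock Y k).row) = ⊤ := by
    have hY : Submodule.span ℝ (Set.range Y.row) = ⊤ := by
      apply Submodule.eq_top_of_finrank_eq
      rw [← Matrix.rank_eq_finrank_span_row, hrk]
      simp
    rw [eq_top_iff, ← hY, Submodule.span_le]
    rintro _ ⟨⟨k, a⟩, rfl⟩
    exact Submodule.mem_iSup_of_mem k (Submodule.subset_span ⟨a, rfl⟩)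
  have h := two_mul_finrank_le_of_vanishing (d := d)
    ((ocSpace Y).map (Matrix.toBilin' (R₁ := ℝ) (n := Fin p)).toLinearMap)
    (fun k => Submodule.span ℝ (Set.range (Zblock Y k).row)) ?_ ?_ hrow htop
  · rw [LinearEquiv.finrank_map_eq] at h
    simp only [Module.finrank_fintype_fun_eq_card, Fintype.card_fin] at h
    linarith
  · rintro _ ⟨A, hA, rfl⟩ u v
    simp only [LinearEquiv.coe_coe, Matrix.toBilin'_apply']
    rw [Matrix.dotProduct_mulVec, ← Matrix.mulVec_transpose, hA.1.eq, dotProduct_comm]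
  · rintro k _ ⟨A, hA, rfl⟩ u hu v hv
    induction hu using Submodule.span_induction with
    | zero => simp
    | add x y _ _ hx hy => rw [map_add, LinearMap.add_apply, hx, hy, add_zero]
    | smul r x _ hx => rw [map_smul, LinearMap.smul_apply, hx, smul_zero]
    | mem u hu =>
      obtain ⟨a, rfl⟩ := hu
      induction hv using Submodule.span_induction with
      | zero => simp
      | add x y _ _ hx hy => rw [map_add, hx, hy, add_zero]
      | smul r x _ hx => rw [map_smul, hx, smul_zero]
      | mem v hv =>
        obtain ⟨b, rfl⟩ := hv
        have := congrFun (congrFun (hA.2 k) a) b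
        rw [Matrix.mul_assoc] at this
        exact (Matrix.toBilin'_apply' A _ _).trans this

/-- Repeating the coordinate blocks of `ℝ^{md}` attains the upper bound. -/
lemma exists_two_mul_finrank_ocSpace_eq {d q m : ℕ} (hm : 0 < m) (hmq : m ≤ q) :
    ∃ Y : Matrix (Fin q × Fin d) (Fin (m * d)) ℝ, Y.rank = m * d ∧
      (∀ k : Fin q, Zblock Y k * (Zblock Y k)ᵀ = 1) ∧
      2 * Module.finrank ℝ (ocSpace Y) + (m * d) * (d + 1) = (m * d) * (m * d + 1) := by
  let f : Fin q → Fin m := fun k => if h : k.1 < m then ⟨k, h⟩ else ⟨0, hm⟩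
  have hf : ∀ l : Fin m, f (Fin.castLE hmq l) = l := fun l => by simp [f]
  let X : Matrix (Fin m × Fin d) (Fin (m * d)) ℝ :=
    Matrix.of fun x j => if finProdFinEquiv x = j then 1 else 0
  let Y : Matrix (Fin q × Fin d) (Fin (m * d)) ℝ := Matrix.of fun x j => X (f x.1, x.2) j
  have hrk : Y.rank = m * d := by
    have hinj : Function.Injective Y.mulVecLin := by
      intro u v huv
      ext j
      obtain ⟨⟨l, a⟩, rfl⟩ := finProdFinEquiv.surjective j
      have := congrFun huv (Fin.castLE hmq l, a)
      simpa [Y, X, Matrix.mulVec, dotProduct, hf] using this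
    rw [Matrix.rank, LinearMap.finrank_range_of_inj hinj]
    simp
  have horth : ∀ k : Fin q, Zblock Y k * (Zblock Y k)ᵀ = 1 := by
    intro k
    ext a b
    simp [Zblock, Y, X, Matrix.mul_apply, Matrix.one_apply, eq_comm]
  have hsp : ocSpace Y = ocSpace X := by
    ext A
    refine and_congr_right fun _ => ⟨fun h l => ?_, fun h k => h (f k)⟩
    have := h (Fin.castLE hmq l)
    have hZ : Zblock Y (Fin.castLE hmq l) = Zblock X l := by
      ext a j
      simp [Zblock, Y, hf]
    rwa [hZ] at this
  refine ⟨Y, hrk, horth, le_antisymm (two_mul_finrank_ocSpace_le Y hrk horth) ?_⟩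
  rw [hsp]
  exact le_two_mul_finrank_ocSpace X

/-- Theorem 6 of the paper: for the Orthogonal-Cut SDP with n = qd,
if Y has rank p and each d-row block Z_k of Y has orthonormal rows, then
p(p+1)/2 − n(d+1)/2 ≤ dim V ≤ p(p+1)/2 − p(d+1)/2, where
V = {A ∈ Sym(p,ℝ) : Z_k A Z_kᵀ = 0 ∀k} (stated multiplied by 2 to stay in ℕ);
moreover if d ∣ p the upper bound is attained by some such Y. -/
theorem stmt19 (d q p : ℕ) (hd : 1 ≤ d) (hq : 1 ≤ q) (hdp : d ≤ p) (hpn : p ≤ q * d)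
    (Y : Matrix (Fin q × Fin d) (Fin p) ℝ) (hrk : Y.rank = p)
    (horth : ∀ k : Fin q, Zblock Y k * (Zblock Y k)ᵀ = 1) :
    (p * (p + 1) ≤ 2 * Module.finrank ℝ (ocSpace Y) + (q * d) * (d + 1) ∧
      2 * Module.finrank ℝ (ocSpace Y) + p * (d + 1) ≤ p * (p + 1)) ∧
    (d ∣ p → ∃ Y' : Matrix (Fin q × Fin d) (Fin p) ℝ, Y'.rank = p ∧
      (∀ k : Fin q, Zblock Y' k * (Zblock Y' k)ᵀ = 1) ∧
      2 * Module.finrank ℝ (ocSpace Y') + p * (d + 1) = p * (p + 1)) := by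
  refine ⟨⟨le_two_mul_finrank_ocSpace Y, two_mul_finrank_ocSpace_le Y hrk horth⟩, ?_⟩
  rintro ⟨m, rfl⟩
  rw [mul_comm d m] at *
  exact exists_two_mul_finrank_ocSpace_eq (Nat.pos_of_mul_pos_right (by omega : 0 < m * d))
    (Nat.le_of_mul_le_mul_right hpn hd)
end
end
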